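/- Let (E, {f_i}_{i=1}^m) ∈ 𝓔 with convex hull I. If f_1(I) ∩ f_2(I) = ∅ but f_{m−1}(I) ∩ f_m(I) ≠ ∅, then for every integer k ≥ 1, dim_H U_k(E) ≥ dim_H U_1(E). -/

import Mathlib

open Set Filter MeasureTheory

/-- A self-similar iterated function system on `ℝ` given by `m` similitudes
`f i x = r i * x + t i` (for `1 ≤ i ≤ m`, `m ≥ 3`), together with its attractor `E`:
the unique nonempty compact set with `E = ⋃_{i=1}^m f_i(E)`. -/
structure ClassE where
  m : ℕ
  r : ℕ → ℝ
  t : ℕ → ℝ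
  E : Set ℝ
  hm : 3 ≤ m
  hr : ∀ i, 1 ≤ i → i ≤ m → 0 < r i ∧ r i < 1
  hEne : E.Nonempty
  hEcpt : IsCompact E
  hEinv : E = ⋃ i ∈ Finset.Icc 1 m, (fun x => r i * x + t i) '' E

namespace ClassE

/-- The `i`-th similitude. -/
def f (S : ClassE) (i : ℕ) (x : ℝ) : ℝ := S.r i * x + S.t i

/-- Left endpoint `a` of the convex hull of `E`. -/
noncomputable def a (S : ClassE) : ℝ := sInf S.E

/-- Right endpoint `b` of the convex hull of `E`. -/
noncomputable def b (S : ClassE) : ℝ := sSup S.E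

/-- The convex hull `I = [a, b]` of `E`. -/
noncomputable def I (S : ClassE) : Set ℝ := Set.Icc S.a S.b

/-- Condition (A): `a = f_1(a) < f_2(a) < ⋯ < f_m(a) < f_m(b) = b`. -/
def condA (S : ClassE) : Prop :=
  S.f 1 S.a = S.a ∧ (∀ i, 1 ≤ i → i < S.m → S.f i S.a < S.f (i + 1) S.a) ∧
    S.f S.m S.a < S.f S.m S.b ∧ S.f S.m S.b = S.b

/-- Condition (B): `f_i(I) ∩ f_{i+2}(I) = ∅` for all `1 ≤ i ≤ m - 2`. -/
def condB (S : ClassE) : Prop :=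
  ∀ i, 1 ≤ i → i + 2 ≤ S.m → S.f i '' S.I ∩ S.f (i + 2) '' S.I = ∅

/-- Condition (C): there are `i, j ∈ {1, …, m-1}` with `f_i(I) ∩ f_{i+1}(I) = ∅` and
`f_j(I) ∩ f_{j+1}(I) ≠ ∅`. -/
def condC (S : ClassE) : Prop :=
  (∃ i, 1 ≤ i ∧ i + 1 ≤ S.m ∧ S.f i '' S.I ∩ S.f (i + 1) '' S.I = ∅) ∧
    (∃ j, 1 ≤ j ∧ j + 1 ≤ S.m ∧ S.f j '' S.I ∩ S.f (j + 1) '' S.I ≠ ∅)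

/-- Condition (D): whenever `f_i(I) ∩ f_{i+1}(I) ≠ ∅` there are `u, v ≥ 1` with
`f_i(I) ∩ f_{i+1}(I) = f_i ∘ f_m^u (I) = f_{i+1} ∘ f_1^v (I)`. -/
def condD (S : ClassE) : Prop :=
  ∀ i, 1 ≤ i → i + 1 ≤ S.m → S.f i '' S.I ∩ S.f (i + 1) '' S.I ≠ ∅ →
    ∃ u v : ℕ, 1 ≤ u ∧ 1 ≤ v ∧
      S.f i '' S.I ∩ S.f (i + 1) '' S.I = (S.f i ∘ (S.f S.m)^[u]) '' S.I ∧
      S.f i '' S.I ∩ S.f (i + 1) '' S.I = (S.f (i + 1) ∘ (S.f 1)^[v]) '' S.I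

/-- Membership in the class `𝓔`: conditions (A)–(D). -/
def goodE (S : ClassE) : Prop := S.condA ∧ S.condB ∧ S.condC ∧ S.condD

/-- `prefixMap d n = f_{d 0} ∘ f_{d 1} ∘ ⋯ ∘ f_{d (n-1)}`. -/
def prefixMap (S : ClassE) (d : ℕ → ℕ) : ℕ → ℝ → ℝ
  | 0 => id
  | n + 1 => S.prefixMap d n ∘ S.f (d n)

/-- `d : ℕ → ℕ` (with digits in `{1, …, m}`) is a coding of `x` if
`x = lim_n f_{d 0} ∘ ⋯ ∘ f_{d (n-1)} (0)`. -/
def isCoding (S : ClassE) (d : ℕ → ℕ) (x : ℝ) : Prop :=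
  (∀ n, 1 ≤ d n ∧ d n ≤ S.m) ∧
    Tendsto (fun n => S.prefixMap d n 0) atTop (nhds x)

/-- The set of codings of `x`. -/
def codings (S : ClassE) (x : ℝ) : Set (ℕ → ℕ) := {d | S.isCoding d x}

/-- `U k E`: the set of points of `E` having exactly `k` distinct codings
(`k` a cardinal; e.g. `k = ℵ₀` for countably infinitely many codings,
`k = 𝔠 = 2^ℵ₀` for a continuum of codings). -/
def U (S : ClassE) (k : Cardinal) : Set ℝ :=
  {x ∈ S.E | Cardinal.mk (S.codings x) = k}

end ClassE

open ClassE

namespace ClassE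

def cns (i : ℕ) (d : ℕ → ℕ) : ℕ → ℕ := fun n => Nat.casesOn n i d

theorem cns_inj (i : ℕ) : Function.Injective (cns i) := by
  intro d e h
  funext n
  exact congrFun h (n + 1)

theorem cns_eta (d : ℕ → ℕ) : cns (d 0) (fun n => d (n + 1)) = d := by
  funext n
  cases n <;> rfl

theorem prefix_cns (S : ClassE) (i : ℕ) (d : ℕ → ℕ) (n : ℕ) :
    S.prefixMap (cns i d) (n + 1) = S.f i ∘ S.prefixMap d n := by
  induction n with
  | zero => rfl
  | succ n ih =>
    have h : S.prefixMap (cns i d) (n + 1 + 1) =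
      S.prefixMap (cns i d) (n + 1) ∘ S.f (d n) := rfl
    rw [h, ih]
    rfl

theorem f_inj (S : ClassE) {i : ℕ} (hi : 1 ≤ i ∧ i ≤ S.m) : Function.Injective (S.f i) := by
  intro x y h
  have := (S.hr i hi.1 hi.2).1
  simp only [f] at h
  exact mul_left_cancel₀ this.ne' (by linarith)

theorem f_mono (S : ClassE) {i : ℕ} (hi : 1 ≤ i ∧ i ≤ S.m) : StrictMono (S.f i) := by
  intro x y h
  have := (S.hr i hi.1 hi.2).1
  simp only [f]
  nlinarith

theorem f_cont (S : ClassE) (i : ℕ) : Continuous (S.f i) := by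
  unfold f; fun_prop

theorem coding_cns (S : ClassE) {i : ℕ} (hi : 1 ≤ i ∧ i ≤ S.m) {d : ℕ → ℕ} {z : ℝ}
    (h : S.isCoding d z) : S.isCoding (cns i d) (S.f i z) := by
  refine ⟨?_, ?_⟩
  · intro n
    cases n with
    | zero => exact hi
    | succ n => exact h.1 n
  · rw [← tendsto_add_atTop_iff_nat 1]
    simp only [prefix_cns]
    exact ((S.f_cont i).tendsto z).comp h.2

theorem coding_tail (S : ClassE) {d : ℕ → ℕ} {y : ℝ} (h : S.isCoding d y) :
    ∃ z, y = S.f (d 0) z ∧ S.isCoding (fun n => d (n + 1)) z := by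
  have hr := (S.hr (d 0) (h.1 0).1 (h.1 0).2).1
  refine ⟨(y - S.t (d 0)) / S.r (d 0), ?_, fun n => h.1 (n + 1), ?_⟩
  · simp only [f]; field_simp; ring
  · have h2 := h.2
    rw [← cns_eta d, ← tendsto_add_atTop_iff_nat 1] at h2
    simp only [prefix_cns] at h2
    have h3 := (h2.sub_const (S.t (d 0))).div_const (S.r (d 0))
    refine h3.congr ?_
    intro n
    simp only [Function.comp, f]
    field_simp
    ring

theorem E_sub_I (S : ClassE) : S.E ⊆ S.I := fun _ hx =>
  ⟨csInf_le S.hEcpt.bddBelow hx, le_csSup S.hEcpt.bddAbove hx⟩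

theorem f_mem_E (S : ClassE) {i : ℕ} (hi : 1 ≤ i ∧ i ≤ S.m) {x : ℝ} (hx : x ∈ S.E) :
    S.f i x ∈ S.E := by
  rw [S.hEinv]
  simp only [mem_iUnion]
  exact ⟨i, Finset.mem_Icc.2 hi, x, hx, rfl⟩

theorem a_mem (S : ClassE) : S.a ∈ S.E := S.hEcpt.sInf_mem S.hEne
theorem b_mem (S : ClassE) : S.b ∈ S.E := S.hEcpt.sSup_mem S.hEne

theorem f_mem_I (S : ClassE) {i : ℕ} (hi : 1 ≤ i ∧ i ≤ S.m) {x : ℝ} (hx : x ∈ S.I) :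
    S.f i x ∈ S.I :=
  ⟨(S.E_sub_I (S.f_mem_E hi S.a_mem)).1.trans ((S.f_mono hi).monotone hx.1),
   ((S.f_mono hi).monotone hx.2).trans (S.E_sub_I (S.f_mem_E hi S.b_mem)).2⟩

theorem it_mem_I (S : ClassE) {i : ℕ} (hi : 1 ≤ i ∧ i ≤ S.m) {x : ℝ} (hx : x ∈ S.I) (n : ℕ) :
    (S.f i)^[n] x ∈ S.I := by
  induction n with
  | zero => exact hx
  | succ n ih => rw [Function.iterate_succ_apply']; exact S.f_mem_I hi ih

theorem it_mem_E (S : ClassE) {i : ℕ} (hi : 1 ≤ i ∧ i ≤ S.m) {x : ℝ} (hx : x ∈ S.E) (n : ℕ) :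
    (S.f i)^[n] x ∈ S.E := by
  induction n with
  | zero => exact hx
  | succ n ih => rw [Function.iterate_succ_apply']; exact S.f_mem_E hi ih

theorem exists_rho (S : ClassE) : ∃ ρ : ℝ, 0 ≤ ρ ∧ ρ < 1 ∧ ∀ i, 1 ≤ i → i ≤ S.m → S.r i ≤ ρ := by
  have hne : (Finset.Icc 1 S.m).Nonempty := ⟨1, by have := S.hm; simp; omega⟩
  obtain ⟨j, hj, hmax⟩ := Finset.exists_max_image (Finset.Icc 1 S.m) S.r hne
  rw [Finset.mem_Icc] at hj
  have := S.hr j hj.1 hj.2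
  exact ⟨S.r j, this.1.le, this.2, fun i h1 h2 => hmax i (Finset.mem_Icc.2 ⟨h1, h2⟩)⟩

theorem prefix_dist (S : ClassE) {ρ : ℝ} (h0 : 0 ≤ ρ)
    (hρ : ∀ i, 1 ≤ i → i ≤ S.m → S.r i ≤ ρ) {d : ℕ → ℕ} (hd : ∀ n, 1 ≤ d n ∧ d n ≤ S.m)
    (n : ℕ) : ∀ x y, |S.prefixMap d n x - S.prefixMap d n y| ≤ ρ ^ n * |x - y| := by
  induction n with
  | zero => intro x y; simp [prefixMap]
  | succ n ih =>
    intro x y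
    have h := ih (S.f (d n) x) (S.f (d n) y)
    have e : S.f (d n) x - S.f (d n) y = S.r (d n) * (x - y) := by simp only [f]; ring
    rw [e, abs_mul, abs_of_pos (S.hr _ (hd n).1 (hd n).2).1] at h
    refine h.trans ?_
    rw [pow_succ, mul_assoc]
    gcongr
    exact hρ _ (hd n).1 (hd n).2

theorem prefix_mem_I (S : ClassE) {d : ℕ → ℕ} (hd : ∀ n, 1 ≤ d n ∧ d n ≤ S.m)
    (n : ℕ) : ∀ x ∈ S.I, S.prefixMap d n x ∈ S.I := by
  induction n with
  | zero => intro x hx; exact hx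
  | succ n ih => intro x hx; exact ih _ (S.f_mem_I (hd n) hx)

theorem coding_mem_I (S : ClassE) {d : ℕ → ℕ} {x : ℝ} (h : S.isCoding d x) : x ∈ S.I := by
  obtain ⟨ρ, h0, h1, hρ⟩ := S.exists_rho
  have hlim : Tendsto (fun n => S.prefixMap d n S.a - S.prefixMap d n 0) atTop (nhds 0) := by
    have h3 : Tendsto (fun n : ℕ => ρ ^ n * |S.a - 0|) atTop (nhds 0) := by
      simpa using (tendsto_pow_atTop_nhds_zero_of_lt_one h0 h1).mul_const (|S.a - 0|)
    exact squeeze_zero_norm (fun n => S.prefix_dist h0 hρ h.1 n _ _) h3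
  have h2 := hlim.add h.2
  simp only [sub_add_cancel, zero_add] at h2
  exact isClosed_Icc.mem_of_tendsto h2
    (Eventually.of_forall fun n => S.prefix_mem_I h.1 n _ (S.E_sub_I S.a_mem))

theorem coding_dec (S : ClassE) {d : ℕ → ℕ} {y : ℝ} (h : S.isCoding d y) :
    ∃ z ∈ S.I, y = S.f (d 0) z ∧ ∃ e ∈ S.codings z, cns (d 0) e = d := by
  obtain ⟨z, hz, hc⟩ := S.coding_tail h
  exact ⟨z, S.coding_mem_I hc, hz, _, hc, cns_eta d⟩

theorem mono_a (S : ClassE) (hA : S.condA) {i j : ℕ} (hi : 1 ≤ i) (hij : i ≤ j) (hj : j ≤ S.m) :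
    S.f i S.a ≤ S.f j S.a := by
  induction j, hij using Nat.le_induction with
  | base => exact le_rfl
  | succ j hij ih => exact (ih (by omega)).trans (hA.2.1 j (by omega) (by omega)).le

theorem ab (S : ClassE) : S.a ≤ S.b := (S.E_sub_I S.a_mem).2

theorem lt_of_disj (S : ClassE) {i j : ℕ} (hi : 1 ≤ i ∧ i ≤ S.m) (hj : 1 ≤ j ∧ j ≤ S.m)
    (hle : S.f i S.a ≤ S.f j S.a) (hd : S.f i '' S.I ∩ S.f j '' S.I = ∅) :
    S.f i S.b < S.f j S.a := by
  by_contra hcon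
  push Not at hcon
  have : S.f j S.a ∈ S.f i '' S.I ∩ S.f j '' S.I := by
    refine ⟨?_, S.a, ⟨le_rfl, S.ab⟩, rfl⟩
    exact intermediate_value_Icc S.ab (S.f_cont i).continuousOn ⟨hle, hcon⟩
  rw [hd] at this
  exact this

/-- words with first digits at distance at least two are separated -/
theorem sep (S : ClassE) (hA : S.condA) (hB : S.condB) {i j : ℕ} (hi : 1 ≤ i)
    (hij : i + 2 ≤ j) (hj : j ≤ S.m) {x y : ℝ} (hx : x ∈ S.I) (hy : y ∈ S.I) :
    S.f i x ≠ S.f j y := by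
  have h1 := S.lt_of_disj ⟨hi, by omega⟩ ⟨by omega, by omega⟩
    (S.mono_a hA hi (by omega : i ≤ i + 2) (by omega)) (hB i hi (by omega))
  have h2 := S.mono_a hA (by omega) hij hj
  have h3 := (S.f_mono (i := i) ⟨hi, by omega⟩).monotone hx.2
  have h4 := (S.f_mono (i := j) ⟨by omega, hj⟩).monotone hy.1
  intro h
  linarith

theorem sep1 (S : ClassE) (hA : S.condA) 
    (h1 : S.f 1 '' S.I ∩ S.f 2 '' S.I = ∅) {j : ℕ} 
    (hij : 2 ≤ j) (hj : j ≤ S.m) {x y : ℝ} (hx : x ∈ S.I) (hy : y ∈ S.I) :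
    S.f 1 x ≠ S.f j y := by
  have hm := S.hm
  have h1 := S.lt_of_disj ⟨le_rfl, by omega⟩ ⟨by omega, by omega⟩
    (S.mono_a hA le_rfl (by omega : 1 ≤ 2) (by omega)) h1
  have h2 := S.mono_a hA (by omega) hij hj
  have h3 := (S.f_mono (i := 1) ⟨le_rfl, by omega⟩).monotone hx.2
  have h4 := (S.f_mono (i := j) ⟨by omega, hj⟩).monotone hy.1
  intro h
  linarith

def IsAff (g : ℝ → ℝ) : Prop := ∃ p q : ℝ, 0 < p ∧ ∀ x, g x = p * x + q

theorem aff_f (S : ClassE) {i : ℕ} (hi : 1 ≤ i ∧ i ≤ S.m) : IsAff (S.f i) :=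
  ⟨S.r i, S.t i, (S.hr i hi.1 hi.2).1, fun _ => rfl⟩

theorem IsAff.comp {g h : ℝ → ℝ} (hg : IsAff g) (hh : IsAff h) : IsAff (g ∘ h) := by
  obtain ⟨p, q, hp, e⟩ := hg
  obtain ⟨p', q', hp', e'⟩ := hh
  exact ⟨p * p', p * q' + q, mul_pos hp hp', fun x => by simp only [Function.comp, e, e']; ring⟩

theorem IsAff.iter {g : ℝ → ℝ} (hg : IsAff g) (n : ℕ) : IsAff g^[n] := by
  induction n with
  | zero => exact ⟨1, 0, one_pos, fun x => by simp⟩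
  | succ n ih => rw [Function.iterate_succ]; exact ih.comp hg

theorem IsAff.strictMono {g : ℝ → ℝ} (hg : IsAff g) : StrictMono g := by
  obtain ⟨p, q, hp, e⟩ := hg
  intro x y h
  rw [e, e]
  nlinarith

theorem IsAff.eq_of_image {g h : ℝ → ℝ} (hg : IsAff g) (hh : IsAff h) {a b : ℝ} (hab : a < b)
    (he : g '' Icc a b = h '' Icc a b) : g = h := by
  have key : ∀ {g h : ℝ → ℝ}, IsAff g → IsAff h → g '' Icc a b = h '' Icc a b →
      h a ≤ g a ∧ g b ≤ h b := by
    intro g h hg hh he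
    constructor
    · have : g a ∈ h '' Icc a b := he ▸ ⟨a, ⟨le_rfl, hab.le⟩, rfl⟩
      obtain ⟨z, hz, e⟩ := this
      rw [← e]; exact hh.strictMono.monotone hz.1
    · have : g b ∈ h '' Icc a b := he ▸ ⟨b, ⟨hab.le, le_rfl⟩, rfl⟩
      obtain ⟨z, hz, e⟩ := this
      rw [← e]; exact hh.strictMono.monotone hz.2
  have k1 := key hg hh he
  have k2 := key hh hg he.symm
  have ea : g a = h a := le_antisymm k2.1 k1.1
  have eb : g b = h b := le_antisymm k1.2 k2.2
  obtain ⟨p, q, hp, e⟩ := hg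
  obtain ⟨p', q', hp', e'⟩ := hh
  rw [e, e'] at ea eb
  have hpp : p = p' := by
    have : (p - p') * (b - a) = 0 := by linarith
    rcases mul_eq_zero.1 this with h | h <;> linarith
  subst hpp
  funext x
  rw [e, e']
  linarith

theorem IsAff.dimH_image_le {g : ℝ → ℝ} (hg : IsAff g) (s : Set ℝ) : dimH (g '' s) ≤ dimH s := by
  obtain ⟨p, q, hp, e⟩ := hg
  have : LipschitzWith p.toNNReal g := by
    refine LipschitzWith.of_dist_le_mul fun x y => ?_
    rw [Real.coe_toNNReal _ hp.le, Real.dist_eq, Real.dist_eq, e, e, ← abs_of_pos hp, ← abs_mul,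
      abs_of_pos hp]
    apply le_of_eq; congr 1; ring
  exact this.dimH_image_le s

theorem IsAff.le_dimH_image {g : ℝ → ℝ} (hg : IsAff g) (s : Set ℝ) : dimH s ≤ dimH (g '' s) := by
  obtain ⟨p, q, hp, e⟩ := hg
  have hh : IsAff (fun y => p⁻¹ * y + (- q / p)) := ⟨_, _, inv_pos.2 hp, fun _ => rfl⟩
  have := hh.dimH_image_le (g '' s)
  rw [image_image] at this
  convert this
  ext x
  simp only [mem_image, e]
  have : ∀ x, p⁻¹ * (p * x + q) + -q / p = x := by intro x; field_simp; ring
  simp [this]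

/-- number of codings -/
theorem mk_f1 (S : ClassE) (hA : S.condA) (h1 : S.f 1 '' S.I ∩ S.f 2 '' S.I = ∅)
    {z : ℝ} (hz : z ∈ S.I) :
    Cardinal.mk (S.codings (S.f 1 z)) = Cardinal.mk (S.codings z) := by
  have hm := S.hm
  have : S.codings (S.f 1 z) = cns 1 '' S.codings z := by
    ext d
    constructor
    · intro hd
      obtain ⟨w, hw, he, e, hec, hed⟩ := S.coding_dec hd
      have h0 := hd.1 0
      by_cases hd1 : d 0 = 1
      · rw [hd1] at he hed
        have := S.f_inj ⟨le_rfl, by omega⟩ he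
        subst this
        exact ⟨e, hec, hed⟩
      · exact absurd he (S.sep1 hA h1 (by omega) h0.2 hz hw)
    · rintro ⟨e, he, rfl⟩
      exact S.coding_cns ⟨le_rfl, by omega⟩ he
  rw [this, Cardinal.mk_image_eq (cns_inj 1)]

theorem mk_f1_it (S : ClassE) (hA : S.condA) (h1 : S.f 1 '' S.I ∩ S.f 2 '' S.I = ∅)
    {z : ℝ} (hz : z ∈ S.I) (n : ℕ) :
    Cardinal.mk (S.codings ((S.f 1)^[n] z)) = Cardinal.mk (S.codings z) := by
  have hm := S.hm
  induction n with
  | zero => rfl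
  | succ n ih =>
    rw [Function.iterate_succ_apply', S.mk_f1 hA h1 (S.it_mem_I ⟨le_rfl, by omega⟩ hz n), ih]

theorem mk_fm (S : ClassE) (hA : S.condA) (hB : S.condB) {v : ℕ} (hv : 1 ≤ v)
    (hD : S.f (S.m - 1) '' S.I ∩ S.f S.m '' S.I = (S.f S.m ∘ (S.f 1)^[v]) '' S.I)
    {z : ℝ} (hz : z ∈ S.I) (hz1 : z ∉ S.f 1 '' S.I) :
    Cardinal.mk (S.codings (S.f S.m z)) = Cardinal.mk (S.codings z) := by
  have hm := S.hm
  have : S.codings (S.f S.m z) = cns S.m '' S.codings z := by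
    ext d
    constructor
    · intro hd
      obtain ⟨w, hw, he, e, hec, hed⟩ := S.coding_dec hd
      have h0 := hd.1 0
      by_cases hd1 : d 0 = S.m
      · rw [hd1] at he hed
        have := S.f_inj ⟨by omega, le_rfl⟩ he
        subst this
        exact ⟨e, hec, hed⟩
      · by_cases hd2 : d 0 = S.m - 1
        · exfalso
          rw [hd2] at he
          have hmem : S.f S.m z ∈ S.f (S.m - 1) '' S.I ∩ S.f S.m '' S.I :=
            ⟨⟨w, hw, he.symm⟩, ⟨z, hz, rfl⟩⟩
          rw [hD] at hmem
          obtain ⟨x, hx, hxe⟩ := hmem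
          have := S.f_inj ⟨by omega, le_rfl⟩ hxe
          apply hz1
          rw [← this]
          obtain ⟨v', rfl⟩ : ∃ v', v = v' + 1 := ⟨v - 1, by omega⟩
          rw [Function.iterate_succ_apply']
          exact ⟨_, S.it_mem_I ⟨le_rfl, by omega⟩ hx v', rfl⟩
        · exact absurd he.symm (S.sep hA hB h0.1 (by omega) le_rfl hw hz)
    · rintro ⟨e, he, rfl⟩
      exact S.coding_cns ⟨by omega, le_rfl⟩ he
  rw [this, Cardinal.mk_image_eq (cns_inj _)]

theorem mk_fm_it (S : ClassE) (hA : S.condA) (hB : S.condB)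
    (h1 : S.f 1 '' S.I ∩ S.f 2 '' S.I = ∅) {v : ℕ} (hv : 1 ≤ v)
    (hD : S.f (S.m - 1) '' S.I ∩ S.f S.m '' S.I = (S.f S.m ∘ (S.f 1)^[v]) '' S.I)
    {z : ℝ} (hz : z ∈ S.I) (u : ℕ) :
    Cardinal.mk (S.codings ((S.f S.m)^[u + 1] z)) = Cardinal.mk (S.codings (S.f S.m z)) := by
  have hm := S.hm
  induction u with
  | zero => rfl
  | succ u ih =>
    rw [Function.iterate_succ_apply', S.mk_fm hA hB hv hD (S.it_mem_I ⟨by omega, le_rfl⟩ hz _), ih]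
    rintro ⟨x, hx, he⟩
    rw [Function.iterate_succ_apply'] at he
    exact S.sep1 hA h1 (by omega) le_rfl hx (S.it_mem_I ⟨by omega, le_rfl⟩ hz _) he

theorem mk_g (S : ClassE) (hA : S.condA) (hB : S.condB) {u v : ℕ}
    (hg : S.f (S.m - 1) ∘ (S.f S.m)^[u] = S.f S.m ∘ (S.f 1)^[v])
    {x : ℝ} (hx : x ∈ S.I) :
    Cardinal.mk (S.codings (S.f S.m ((S.f 1)^[v] x))) =
      Cardinal.mk (S.codings ((S.f 1)^[v] x)) + Cardinal.mk (S.codings ((S.f S.m)^[u] x)) := by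
  have hm := S.hm
  have hgx : S.f (S.m - 1) ((S.f S.m)^[u] x) = S.f S.m ((S.f 1)^[v] x) := congrFun hg x
  have : S.codings (S.f S.m ((S.f 1)^[v] x)) =
      cns S.m '' S.codings ((S.f 1)^[v] x) ∪ cns (S.m - 1) '' S.codings ((S.f S.m)^[u] x) := by
    ext d
    constructor
    · intro hd
      obtain ⟨w, hw, he, e, hec, hed⟩ := S.coding_dec hd
      have h0 := hd.1 0
      by_cases hd1 : d 0 = S.m
      · left
        rw [hd1] at he hed
        have := S.f_inj ⟨by omega, le_rfl⟩ he
        subst this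
        exact ⟨e, hec, hed⟩
      · by_cases hd2 : d 0 = S.m - 1
        · right
          rw [hd2] at he hed
          rw [← hgx] at he
          have := S.f_inj ⟨by omega, by omega⟩ he
          subst this
          exact ⟨e, hec, hed⟩
        · exact absurd he.symm (S.sep hA hB h0.1 (by omega) le_rfl hw
            (S.it_mem_I ⟨le_rfl, by omega⟩ hx _))
    · rintro (⟨e, he, rfl⟩ | ⟨e, he, rfl⟩)
      · exact S.coding_cns ⟨by omega, le_rfl⟩ he
      · rw [← hgx]
        exact S.coding_cns ⟨by omega, by omega⟩ he
  rw [this, Cardinal.mk_union_of_disjoint, Cardinal.mk_image_eq (cns_inj _),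
    Cardinal.mk_image_eq (cns_inj _)]
  rw [Set.disjoint_left]
  rintro _ ⟨e, _, rfl⟩ ⟨e', _, h⟩
  have : S.m - 1 = S.m := congrFun h 0
  omega

theorem mk_main (S : ClassE) (hA : S.condA) (hB : S.condB)
    (h1 : S.f 1 '' S.I ∩ S.f 2 '' S.I = ∅) {u v : ℕ} (hu : 1 ≤ u) (hv : 1 ≤ v)
    (hD : S.f (S.m - 1) '' S.I ∩ S.f S.m '' S.I = (S.f S.m ∘ (S.f 1)^[v]) '' S.I)
    (hg : S.f (S.m - 1) ∘ (S.f S.m)^[u] = S.f S.m ∘ (S.f 1)^[v])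
    {w : ℝ} (hw : w ∈ S.I) (hw1 : w ∉ S.f 1 '' S.I) (hc : Cardinal.mk (S.codings w) = 1) (n : ℕ) :
    Cardinal.mk (S.codings (S.f S.m ((S.f 1)^[v * n] w))) = ((n + 1 : ℕ) : Cardinal) := by
  have hm := S.hm
  induction n with
  | zero => simpa [hc] using S.mk_fm hA hB hv hD hw hw1
  | succ n ih =>
    have hx := S.it_mem_I (i := 1) ⟨le_rfl, by omega⟩ hw (v * n)
    obtain ⟨u, rfl⟩ : ∃ u', u = u' + 1 := ⟨u - 1, by omega⟩
    rw [show v * (n + 1) = v + v * n by ring, Function.iterate_add_apply, S.mk_g hA hB hg hx,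
      S.mk_f1_it hA h1 hx, S.mk_f1_it hA h1 hw, S.mk_fm_it hA hB h1 hv hD hx, ih, hc]
    push_cast
    rw [add_comm]

theorem mem_E_of_f1 (S : ClassE) (hA : S.condA) (h1 : S.f 1 '' S.I ∩ S.f 2 '' S.I = ∅)
    {z : ℝ} (hz : z ∈ S.I) (n : ℕ) (h : (S.f 1)^[n] z ∈ S.E) : z ∈ S.E := by
  have hm := S.hm
  induction n with
  | zero => exact h
  | succ n ih =>
    apply ih
    rw [Function.iterate_succ_apply', S.hEinv] at h
    simp only [mem_iUnion, Finset.mem_Icc] at h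
    obtain ⟨j, hj, e, he, hfe⟩ := h
    change S.f j e = _ at hfe
    have hI := S.it_mem_I (i := 1) ⟨le_rfl, by omega⟩ hz n
    by_cases hj1 : j = 1
    · subst hj1
      rw [← S.f_inj hj hfe]
      exact he
    · exact absurd hfe.symm (S.sep1 hA h1 (by omega) hj.2 hI (S.E_sub_I he))

theorem f1_it_dist (S : ClassE) (hA : S.condA) (z : ℝ) (n : ℕ) :
    (S.f 1)^[n] z - S.a = S.r 1 ^ n * (z - S.a) := by
  induction n with
  | zero => simp
  | succ n ih =>
    rw [Function.iterate_succ_apply', pow_succ', mul_assoc, ← ih]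
    have := hA.1
    simp only [f] at this ⊢
    linarith

theorem U1_sub (S : ClassE) (hA : S.condA) (h1 : S.f 1 '' S.I ∩ S.f 2 '' S.I = ∅) :
    S.U 1 ⊆ {S.a} ∪ ⋃ n : ℕ, (S.f 1)^[n] '' (S.U 1 \ S.f 1 '' S.I) := by
  have hm := S.hm
  have hr := S.hr 1 le_rfl (by omega)
  intro x hx
  by_cases hall : ∀ n : ℕ, x ∈ (S.f 1)^[n] '' S.I
  · left
    have hb : ∀ n : ℕ, |x - S.a| ≤ S.r 1 ^ n * (S.b - S.a) := by
      intro n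
      obtain ⟨z, hz, rfl⟩ := hall n
      rw [S.f1_it_dist hA, abs_of_nonneg (mul_nonneg (pow_nonneg hr.1.le _) (by linarith [hz.1]))]
      have := pow_nonneg hr.1.le n
      gcongr
      exact hz.2
    have hl : Tendsto (fun n : ℕ => S.r 1 ^ n * (S.b - S.a)) atTop (nhds 0) := by
      simpa using (tendsto_pow_atTop_nhds_zero_of_lt_one hr.1.le hr.2).mul_const (S.b - S.a)
    have := ge_of_tendsto' hl hb
    have h0 : x - S.a = 0 := abs_eq_zero.1 (le_antisymm this (abs_nonneg _))
    exact sub_eq_zero.1 h0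
  · right
    push Not at hall
    classical
    have hs := Nat.find_spec hall
    have hmin := fun k => Nat.find_min hall (m := k)
    generalize Nat.find hall = n at hs hmin
    cases n with
    | zero => exact absurd ⟨x, S.E_sub_I hx.1, rfl⟩ hs
    | succ k =>
      have hk := hmin k (by omega)
      push Not at hk
      obtain ⟨z, hz, rfl⟩ := hk
      refine mem_iUnion.2 ⟨k, z, ⟨⟨S.mem_E_of_f1 hA h1 hz k hx.1, ?_⟩, ?_⟩, rfl⟩
      · rw [← S.mk_f1_it hA h1 hz k]; exact hx.2
      · rintro ⟨y, hy, rfl⟩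
        exact hs ⟨y, hy, by rw [Function.iterate_succ_apply]⟩

end ClassE

theorem stmt11 (S : ClassE) (hS : S.goodE)
    (h1 : S.f 1 '' S.I ∩ S.f 2 '' S.I = ∅)
    (h2 : S.f (S.m - 1) '' S.I ∩ S.f S.m '' S.I ≠ ∅) :
    ∀ k : ℕ, 1 ≤ k → dimH (S.U 1) ≤ dimH (S.U k) := by
  obtain ⟨hA, hB, hC, hD⟩ := hS
  have hm := S.hm
  have hm1 : S.m - 1 + 1 = S.m := by omega
  intro k hk
  obtain ⟨n, rfl⟩ : ∃ n, k = n + 1 := ⟨k - 1, by omega⟩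
  have hDm := hD (S.m - 1) (by omega) (by omega)
  rw [hm1] at hDm
  obtain ⟨u, v, hu, hv, e1, e2⟩ := hDm h2
  have i1 : 1 ≤ 1 ∧ 1 ≤ S.m := ⟨le_rfl, by omega⟩
  have im : 1 ≤ S.m ∧ S.m ≤ S.m := ⟨by omega, le_rfl⟩
  have im1 : 1 ≤ S.m - 1 ∧ S.m - 1 ≤ S.m := ⟨by omega, by omega⟩
  have hab : S.a < S.b := (S.f_mono im).lt_iff_lt.1 hA.2.2.1
  have hg : S.f (S.m - 1) ∘ (S.f S.m)^[u] = S.f S.m ∘ (S.f 1)^[v] :=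
    ((S.aff_f im1).comp ((S.aff_f im).iter u)).eq_of_image
      ((S.aff_f im).comp ((S.aff_f i1).iter v)) hab (e1.symm.trans e2)
  have step1 : dimH (S.U 1) ≤ dimH (S.U 1 \ S.f 1 '' S.I) := by
    refine (dimH_mono (S.U1_sub hA h1)).trans ?_
    rw [dimH_union, dimH_singleton, dimH_iUnion]
    exact max_le bot_le (iSup_le fun n => ((S.aff_f i1).iter n).dimH_image_le _)
  refine step1.trans ((((S.aff_f im).comp ((S.aff_f i1).iter (v * n))).le_dimH_image _).trans
    (dimH_mono ?_))
  rintro _ ⟨w, ⟨hw, hw1⟩, rfl⟩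
  exact ⟨S.f_mem_E im (S.it_mem_E i1 hw.1 _),
    S.mk_main hA hB h1 hu hv e2 hg (S.E_sub_I hw.1) hw1 hw.2 n⟩
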